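/- arXiv:2302.02599 — 6 statements merged into one kernel-verified Lean document; each statement's English description precedes it below -/
import Mathlib

section
/- The function C satisfying the checkpointing recurrence is bounded below by the total compute and communication time of every stage executed once: for all 1 ≤ s ≤ t ≤ L and all real m, C(s,t,m) ≥ Σ_{k=s}^{t} ( u_f^k + u_fc^k + u_b^k + u_bc^k ). -/
open scoped ENNReal

/-- Parameters of an `L`-stage chain with per-stage compute/communication times
and memory overheads/sizes (all nonnegative reals). `uf`/`ub` are forward/backward
compute times, `ufc`/`ubc` forward/backward communication times, `of_`/`ofc`/`ob`/`obc`
memory overheads, `wa` = ω_a (stored forward activation), `wab` = ω_ā (intermediate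
activations), `wd` = ω_δ (backward gradient). -/
structure CkptParams where
  L : ℕ
  hL : 1 ≤ L
  uf : ℕ → NNReal
  ub : ℕ → NNReal
  ufc : ℕ → NNReal
  ubc : ℕ → NNReal
  of_ : ℕ → NNReal
  ofc : ℕ → NNReal
  ob : ℕ → NNReal
  obc : ℕ → NNReal
  wa : ℕ → NNReal
  wab : ℕ → NNReal
  wd : ℕ → NNReal

/-- m_∅^{s,t} = max( ω_δ^t + ω_a^s + o_f^s + o_fc^s ,
      max_{s+1 ≤ j < t}( ω_δ^t + ω_a^{j−1} + ω_a^j + o_f^j + o_fc^j ) ). -/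
noncomputable def mEmpty (P : CkptParams) (s t : ℕ) : NNReal :=
  max (P.wd t + P.wa s + P.of_ s + P.ofc s)
    ((Finset.Ioo s t).sup fun j => P.wd t + P.wa (j - 1) + P.wa j + P.of_ j + P.ofc j)

/-- m_all^{s,t} = max( ω_δ^t + ω_ā^s + o_f^s + o_fc^s , ω_δ^s + ω_ā^s + o_b^s + o_bc^s ). -/
noncomputable def mAll (P : CkptParams) (s t : ℕ) : NNReal :=
  max (P.wd t + P.wab s + P.of_ s + P.ofc s)
    (P.wd s + P.wab s + P.ob s + P.obc s)

/-- Σ_{k=s}^{t} ( u_f^k + u_fc^k + u_b^k + u_bc^k ), the total compute and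
communication time of every stage executed once. -/
noncomputable def totalTime (P : CkptParams) (s t : ℕ) : ℝ≥0∞ :=
  ∑ k ∈ Finset.Icc s t, ((P.uf k + P.ufc k + P.ub k + P.ubc k : NNReal) : ℝ≥0∞)

/-- `C : (s, t, m) ↦ [0,∞]` satisfies the checkpointing recurrence with communication
overheads: the base case `C(s,s,m)` and, for `s < t`,
`C(s,t,m) = min (C₁ s t m) (C₂ s t m)`. -/
def SatisfiesRec (P : CkptParams) (C : ℕ → ℕ → ℝ → ℝ≥0∞) : Prop :=
  (∀ s : ℕ, 1 ≤ s → s ≤ P.L → ∀ m : ℝ,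
    C s s m =
      if ((mAll P s s : NNReal) : ℝ) ≤ m then
        ((P.uf s + P.ufc s + P.ub s + P.ubc s : NNReal) : ℝ≥0∞)
      else ⊤) ∧
  (∀ s t : ℕ, 1 ≤ s → s < t → t ≤ P.L → ∀ m : ℝ,
    C s t m =
      min
        (if ((mEmpty P s t : NNReal) : ℝ) ≤ m then
          ⨅ s' ∈ Finset.Icc (s + 1) t,
            ((∑ k ∈ Finset.Ico s s', ((P.uf k : NNReal) : ℝ≥0∞))
              + C s' t (m - ((P.wa (s' - 1) : NNReal) : ℝ))
              + C s (s' - 1) m)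
        else ⊤)
        (if ((mAll P s t : NNReal) : ℝ) ≤ m then
          ((P.uf s + P.ufc s : NNReal) : ℝ≥0∞)
            + C (s + 1) t (m - ((P.wab s : NNReal) : ℝ))
            + ((P.ub s + P.ubc s : NNReal) : ℝ≥0∞)
        else ⊤))

theorem totalTime_self (P : CkptParams) (s : ℕ) :
    totalTime P s s = ((P.uf s + P.ufc s + P.ub s + P.ubc s : NNReal) : ℝ≥0∞) := by
  simp [totalTime]

theorem totalTime_add_totalTime (P : CkptParams) {s r t : ℕ} (hsr : s ≤ r) (hrt : r < t) :
    totalTime P s r + totalTime P (r + 1) t = totalTime P s t := by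
  simp only [totalTime, ← Finset.Ico_add_one_right_eq_Icc]
  exact Finset.sum_Ico_consecutive _ (by omega) (by omega)

/-- The function `C` satisfying the checkpointing recurrence is bounded below by the
total compute and communication time of every stage executed once:
`C(s,t,m) ≥ Σ_{k=s}^{t} ( u_f^k + u_fc^k + u_b^k + u_bc^k )`. -/
theorem ckpt_recurrence_lower_bound (P : CkptParams)
    (C : ℕ → ℕ → ℝ → ℝ≥0∞) (hC : SatisfiesRec P C) :
    ∀ s t : ℕ, 1 ≤ s → s ≤ t → t ≤ P.L → ∀ m : ℝ,
      C s t m ≥ totalTime P s t := by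
  obtain ⟨hbase, hrec⟩ := hC
  suffices h : ∀ n s t : ℕ, t - s = n → 1 ≤ s → s ≤ t → t ≤ P.L → ∀ m : ℝ,
      totalTime P s t ≤ C s t m from fun s t => h _ s t rfl
  intro n
  induction n using Nat.strong_induction_on with
  | _ n ih =>
    intro s t hn hs hst htL m
    rcases hst.eq_or_lt with rfl | hlt
    · rw [hbase s hs htL m, totalTime_self]
      split_ifs
      · exact le_rfl
      · exact le_top
    rw [hrec s t hs hlt htL m]
    refine le_min ?_ ?_
    · split_ifs
      · refine le_iInf₂ fun s' hs' => ?_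
        obtain ⟨hs₁, hs₂⟩ := Finset.mem_Icc.mp hs'
        obtain ⟨r, rfl⟩ : ∃ r, s' = r + 1 := ⟨s' - 1, by omega⟩
        simp only [Nat.add_sub_cancel]
        rw [← totalTime_add_totalTime P (by omega : s ≤ r) (by omega), add_comm]
        gcongr
        · exact (ih _ (by omega) (r + 1) t rfl (by omega) hs₂ htL _).trans le_add_self
        · exact ih _ (by omega) s r rfl hs (by omega) (by omega) _
      · exact le_top
    · split_ifs
      · rw [← totalTime_add_totalTime P le_rfl hlt, totalTime_self]
        calc _ = ((P.uf s + P.ufc s : NNReal) : ℝ≥0∞) + totalTime P (s + 1) t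
              + ((P.ub s + P.ubc s : NNReal) : ℝ≥0∞) := by push_cast; ring
          _ ≤ _ := by
            gcongr
            exact ih _ (by omega) (s + 1) t rfl (by omega) hlt htL _
      · exact le_top
end

section
/- With unlimited memory the checkpointing recurrence incurs no recomputation: there exists a real number M such that for every m ≥ M and every 1 ≤ s ≤ t ≤ L, the function C satisfying the checkpointing recurrence satisfies C(s,t,m) = Σ_{k=s}^{t} ( u_f^k + u_fc^k + u_b^k + u_bc^k ). -/
open scoped ENNReal

theorem totalTime_split (P : CkptParams) {s r t : ℕ} (hsr : s < r) (hrt : r ≤ t) :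
    totalTime P s t = totalTime P s (r - 1) + totalTime P r t := by
  have hleft : Finset.Icc s (r - 1) = Finset.Ico s r := by
    ext k
    simp only [Finset.mem_Icc, Finset.mem_Ico]
    omega
  have hIcc : ∀ a, Finset.Icc a t = Finset.Ico a (t + 1) := by
    intro a
    ext k
    simp only [Finset.mem_Icc, Finset.mem_Ico]
    omega
  simp only [totalTime, hleft, hIcc]
  exact (Finset.sum_Ico_consecutive _ hsr.le (by omega)).symm

theorem totalTime_eq_first_add (P : CkptParams) {s t : ℕ} (hst : s < t) :
    totalTime P s t = ((P.uf s + P.ufc s : NNReal) : ℝ≥0∞) + totalTime P (s + 1) t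
      + ((P.ub s + P.ubc s : NNReal) : ℝ≥0∞) := by
  rw [totalTime_split P (Nat.lt_succ_self s) hst, Nat.succ_eq_add_one, Nat.add_sub_cancel,
    totalTime_self]
  push_cast
  ring

/-- No schedule is faster than executing every stage exactly once, whatever the memory. -/
theorem SatisfiesRec.totalTime_le {P : CkptParams} {C : ℕ → ℕ → ℝ → ℝ≥0∞}
    (hC : SatisfiesRec P C) (n : ℕ) :
    ∀ s t : ℕ, t - s = n → 1 ≤ s → s ≤ t → t ≤ P.L → ∀ m : ℝ, totalTime P s t ≤ C s t m := by
  induction n using Nat.strong_induction_on with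
  | _ n ih =>
    intro s t hn hs hst ht m
    rcases hst.eq_or_lt with rfl | hst
    · rw [hC.1 s hs ht, totalTime_self]
      split_ifs
      · exact le_rfl
      · exact le_top
    · rw [hC.2 s t hs hst ht]
      refine le_min ?_ ?_
      · split_ifs
        · refine le_iInf₂ fun r hr => ?_
          obtain ⟨hsr, hrt⟩ := Finset.mem_Icc.1 hr
          rw [totalTime_split P hsr hrt, add_comm (totalTime P s (r - 1))]
          gcongr
          · exact (ih (t - r) (by omega) r t rfl (by omega) hrt ht _).trans le_add_self
          · exact ih (r - 1 - s) (by omega) s (r - 1) rfl hs (by omega) (by omega) m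
        · exact le_top
      · split_ifs
        · rw [totalTime_eq_first_add P hst]
          gcongr
          exact ih (t - (s + 1)) (by omega) (s + 1) t rfl (by omega) hst ht _
        · exact le_top

/-- Storing all intermediate activations attains the total time as soon as the memory exceeds
a uniform bound on `mAll` by the size of the stored activations. -/
theorem SatisfiesRec.le_totalTime {P : CkptParams} {C : ℕ → ℕ → ℝ → ℝ≥0∞}
    (hC : SatisfiesRec P C) {A : NNReal}
    (hA : ∀ s t, 1 ≤ s → s ≤ t → t ≤ P.L → mAll P s t ≤ A) (t : ℕ) (ht : t ≤ P.L)
    (s : ℕ) (hst : s ≤ t) :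
    1 ≤ s → ∀ m : ℝ, A + ∑ k ∈ Finset.Ico s t, (P.wab k : ℝ) ≤ m →
      C s t m ≤ totalTime P s t := by
  induction hst using Nat.decreasingInduction with
  | self =>
    intro hs m hm
    have hmem : (mAll P t t : ℝ) ≤ m := by
      have := NNReal.coe_le_coe.2 (hA t t hs le_rfl ht)
      simp only [Finset.Ico_self, Finset.sum_empty, add_zero] at hm
      exact this.trans hm
    rw [hC.1 t hs ht, if_pos hmem, totalTime_self]
  | of_succ s hst ih =>
    intro hs m hm
    rw [Finset.sum_eq_sum_Ico_succ_bot hst] at hm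
    have hmem : (mAll P s t : ℝ) ≤ m := by
      have hle := NNReal.coe_le_coe.2 (hA s t hs hst.le ht)
      have hnonneg : 0 ≤ ∑ k ∈ Finset.Ico (s + 1) t, (P.wab k : ℝ) :=
        Finset.sum_nonneg fun k _ => (P.wab k).coe_nonneg
      linarith [(P.wab s).coe_nonneg]
    rw [hC.2 s t hs hst ht, if_pos hmem, totalTime_eq_first_add P hst]
    refine (min_le_right _ _).trans ?_
    gcongr
    exact ih (by omega) _ (by linarith)

/-- With unlimited memory the checkpointing recurrence incurs no recomputation:
there is `M : ℝ` such that for every `m ≥ M` and every `1 ≤ s ≤ t ≤ L`,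
`C(s,t,m) = Σ_{k=s}^{t} ( u_f^k + u_fc^k + u_b^k + u_bc^k )`. -/
theorem ckpt_recurrence_unlimited_memory (P : CkptParams)
    (C : ℕ → ℕ → ℝ → ℝ≥0∞) (hC : SatisfiesRec P C) :
    ∃ M : ℝ, ∀ m : ℝ, M ≤ m → ∀ s t : ℕ, 1 ≤ s → s ≤ t → t ≤ P.L →
      C s t m = totalTime P s t := by
  let A : NNReal := ∑ s ∈ Finset.Icc 1 P.L, ∑ t ∈ Finset.Icc 1 P.L, mAll P s t
  have hA : ∀ s t, 1 ≤ s → s ≤ t → t ≤ P.L → mAll P s t ≤ A := by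
    intro s t hs hst ht
    calc mAll P s t ≤ ∑ t ∈ Finset.Icc 1 P.L, mAll P s t :=
          Finset.single_le_sum (f := fun t => mAll P s t) (fun _ _ => zero_le)
            (Finset.mem_Icc.2 ⟨hs.trans hst, ht⟩)
      _ ≤ A :=
          Finset.single_le_sum (f := fun s => ∑ t ∈ Finset.Icc 1 P.L, mAll P s t)
            (fun _ _ => zero_le) (Finset.mem_Icc.2 ⟨hs, hst.trans ht⟩)
  refine ⟨A + ∑ k ∈ Finset.range P.L, (P.wab k : ℝ), fun m hm s t hs hst ht =>
    le_antisymm (hC.le_totalTime hA t ht s hst hs m (le_trans ?_ hm))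
      (hC.totalTime_le (t - s) s t rfl hs hst ht m)⟩
  gcongr
  intro k hk
  simp only [Finset.mem_Ico, Finset.mem_range] at *
  omega
end

section
/- Cut points produce a linearized chain of node groups: if 0 = k_0 < k_1 < … < k_r = n are cut points, then every edge (v_i, v_j) of G either has both endpoints in the same group, or its source v_i is the last vertex v_{k_g} of some group g and its target v_j lies in a strictly later group; consequently the only vertex of a group whose output is consumed outside the group is the group's last vertex. -/
/-- `G` is a finite DAG whose vertices `v_1, …, v_n` are identified with `Fin n`
(0-based: `v_i ↔ i - 1`), enumerated in topological order; edges form a finite set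
`E` with `e.1 < e.2` for every edge. `poolSize E k` is `P_k`, the number of edges
`(v_i, v_j)` with `i ≤ k < j` (dependency-pool size after processing the first `k`
nodes). -/
def poolSize {n : ℕ} (E : Finset (Fin n × Fin n)) (k : ℕ) : ℕ :=
  (E.filter fun e => e.1.val < k ∧ k ≤ e.2.val).card

/-- Out-degree of vertex `v` in the edge set `E`. -/
def outdeg {n : ℕ} (E : Finset (Fin n × Fin n)) (v : Fin n) : ℕ :=
  (E.filter fun e => e.1 = v).card

/-- In-degree of vertex `v` in the edge set `E`. -/
def indeg {n : ℕ} (E : Finset (Fin n × Fin n)) (v : Fin n) : ℕ :=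
  (E.filter fun e => e.2 = v).card

/-- If `k s ≤ x < k r`, some step `g ∈ (s, r]` of the sequence satisfies
`k (g - 1) ≤ x < k g`. -/
theorem exists_step_of_le_of_lt (k : ℕ → ℕ) {s r x : ℕ} (hsr : s ≤ r)
    (hs : k s ≤ x) (hr : x < k r) :
    ∃ g, s < g ∧ g ≤ r ∧ k (g - 1) ≤ x ∧ x < k g := by
  induction r, hsr using Nat.le_induction with
  | base => omega
  | succ m hm ih =>
    by_cases h : x < k m
    · obtain ⟨g, h₁, h₂, h₃⟩ := ih h
      exact ⟨g, h₁, h₂.trans m.le_succ, h₃⟩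
    · exact ⟨m + 1, by omega, le_rfl, not_lt.mp h, hr⟩

/-- Cut points `0 = k_0 < k_1 < … < k_r = n` produce a linearized chain of node
groups (group `g` consists of the vertices with 1-based index in `(k_{g-1}, k_g]`,
i.e. 0-based index in `[k_{g-1}, k_g)`): every edge either has both endpoints in the
same group, or its source is the last vertex `v_{k_g}` of some group `g` (0-based
index `k g - 1`, i.e. `e.1.val + 1 = k g`) and its target lies in a strictly later
group; consequently the only vertex of a group whose output is consumed outside the
group is the group's last vertex. -/
theorem cut_points_linearize {n r : ℕ} (E : Finset (Fin n × Fin n))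
    (htopo : ∀ e ∈ E, e.1 < e.2)
    (k : ℕ → ℕ) (hk0 : k 0 = 0) (hkr : k r = n)
    (hmono : ∀ j < r, k j < k (j + 1))
    (hcut : ∀ j, 1 ≤ j → j ≤ r → ∀ e ∈ E, e.1.val + 1 < k j → e.2.val < k j) :
    (∀ e ∈ E,
      (∃ g, 1 ≤ g ∧ g ≤ r ∧
        k (g - 1) ≤ e.1.val ∧ e.1.val < k g ∧
        k (g - 1) ≤ e.2.val ∧ e.2.val < k g) ∨
      (∃ g, 1 ≤ g ∧ g ≤ r ∧ e.1.val + 1 = k g ∧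
        ∃ g', g < g' ∧ g' ≤ r ∧ k (g' - 1) ≤ e.2.val ∧ e.2.val < k g')) ∧
    (∀ e ∈ E, ∀ g, 1 ≤ g → g ≤ r →
      k (g - 1) ≤ e.1.val → e.1.val < k g →
      ¬(k (g - 1) ≤ e.2.val ∧ e.2.val < k g) → e.1.val + 1 = k g) := by
  have last : ∀ e ∈ E, ∀ g, 1 ≤ g → g ≤ r → k (g - 1) ≤ e.1.val → e.1.val < k g →
      ¬(k (g - 1) ≤ e.2.val ∧ e.2.val < k g) → e.1.val + 1 = k g ∧ k g ≤ e.2.val := by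
    intro e he g h₁ hg hle hlt hout
    have hedge : e.1.val < e.2.val := htopo e he
    have := hcut g h₁ hg e he
    omega
  refine ⟨fun e he => ?_, fun e he g h₁ hg hle hlt hout =>
    (last e he g h₁ hg hle hlt hout).1⟩
  obtain ⟨g, h₁, hg, hle, hlt⟩ := exists_step_of_le_of_lt k (Nat.zero_le r)
    (hk0.trans_le e.1.val.zero_le) (e.1.isLt.trans_eq hkr.symm)
  by_cases hin : k (g - 1) ≤ e.2.val ∧ e.2.val < k g
  · exact Or.inl ⟨g, h₁, hg, hle, hlt, hin⟩
  · obtain ⟨heq, hge⟩ := last e he g h₁ hg hle hlt hin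
    exact Or.inr ⟨g, h₁, hg, heq,
      exists_step_of_le_of_lt k hg hge (e.2.isLt.trans_eq hkr.symm)⟩
end

section
/- A vertex v belongs to the common-node closure C(S) if and only if every directed path in G from a source vertex (a vertex with no in-neighbors) to v contains a vertex of S. -/
/-- The common-node closure `C(S)` of a set `S` of vertices (the initially labeled
common nodes): the least set of vertices containing `S` and closed under the
propagation rule "if a vertex has at least one parent (in-neighbor) and every parent
lies in the set, then the vertex lies in the set". -/
inductive CommonClosure {V : Type*} (adj : V → V → Prop) (S : Set V) : V → Prop
  | base (v : V) (hv : v ∈ S) : CommonClosure adj S v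
  | prop (v : V) (hne : ∃ p, adj p v)
      (hp : ∀ p, adj p v → CommonClosure adj S p) : CommonClosure adj S v

/-- The edge relation of a finite acyclic digraph is well-founded. -/
theorem wellFounded_of_finite_of_acyclic {V : Type*} [Finite V] {adj : V → V → Prop}
    (hacyc : ∀ v, ¬ Relation.TransGen adj v v) : WellFounded adj := by
  have : Std.Irrefl (Relation.TransGen adj) := ⟨hacyc⟩
  exact (Finite.wellFounded_of_trans_of_irrefl (Relation.TransGen adj)).mono
    fun _ _ h => Relation.TransGen.single h

/-- Every directed path from a source to a vertex of the closure meets `S`. -/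
theorem CommonClosure.exists_mem_of_isChain {V : Type*} {adj : V → V → Prop} {S : Set V}
    {v : V} (h : CommonClosure adj S v) (w : V) (l : List V) (hw : ∀ p, ¬ adj p w)
    (hl : (w :: l).IsChain adj) (hv : (w :: l).getLast (by simp) = v) :
    ∃ u ∈ w :: l, u ∈ S := by
  induction h generalizing l with
  | base v hvS => exact ⟨v, hv ▸ List.getLast_mem _, hvS⟩
  | prop v hne _ ih =>
    rcases List.eq_nil_or_concat l with rfl | ⟨l, x, rfl⟩
    · obtain ⟨p, hp⟩ := hne
      obtain rfl : w = v := by simpa using hv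
      exact absurd hp (hw p)
    · simp only [List.concat_eq_append, ← List.cons_append] at hl hv ⊢
      obtain rfl : x = v := by simpa using hv
      rw [List.isChain_append] at hl
      obtain ⟨u, hu, huS⟩ := ih ((w :: l).getLast (by simp))
        (hl.2.2 _ (List.getLast_mem_getLast? _) x (by simp)) l hl.1 rfl
      exact ⟨u, List.mem_append_left _ hu, huS⟩

/-- A vertex `v` belongs to the common-node closure `C(S)` of a finite DAG `G` iff
every directed path in `G` from a source vertex (a vertex with no in-neighbors)
to `v` contains a vertex of `S`. Paths are encoded as `w :: l` with `w` a source,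
consecutive vertices adjacent (`List.Chain adj w l`), and last vertex `v`. -/
theorem commonClosure_iff_every_source_path_hits {V : Type*} [Fintype V]
    (adj : V → V → Prop) (hacyc : ∀ v, ¬ Relation.TransGen adj v v)
    (S : Set V) (v : V) :
    CommonClosure adj S v ↔
      ∀ (w : V) (l : List V), (∀ p, ¬ adj p w) → List.Chain adj w l →
        (w :: l).getLast (by simp) = v → ∃ u ∈ w :: l, u ∈ S := by
  refine ⟨fun h w l hw hl hv => h.exists_mem_of_isChain w l hw hl hv, ?_⟩
  induction v using (wellFounded_of_finite_of_acyclic hacyc).induction with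
  | _ v ih =>
    intro h
    by_cases hvS : v ∈ S
    · exact .base v hvS
    by_cases hne : ∃ p, adj p v
    · refine .prop v hne fun p hp => ih p hp fun w l hw hl hlast => ?_
      have hchain : (w :: l ++ [v]).IsChain adj := by
        refine List.isChain_append.2 ⟨hl, List.isChain_singleton v, ?_⟩
        intro x hx y hy
        rw [List.getLast?_eq_some_getLast (List.cons_ne_nil w l), hlast] at hx
        simp only [Option.mem_def, Option.some.injEq, List.head?_cons] at hx hy
        exact hx ▸ hy ▸ hp
      obtain ⟨u, hu, huS⟩ := h w (l ++ [v]) hw hchain (by simp)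
      rw [← List.cons_append, List.mem_append, List.mem_singleton] at hu
      rcases hu with hu | rfl
      · exact ⟨u, hu, huS⟩
      · exact absurd huS hvS
    · obtain ⟨u, hu, huS⟩ := h v [] (not_exists.1 hne) (List.isChain_singleton v) rfl
      rw [List.mem_singleton] at hu
      exact absurd (hu ▸ huS) hvS
end

section
/- A single pass in topological order computes the common-node closure: given a topological enumeration v_1, …, v_n of G, define T_0 = S ∩ {v_1,…,v_n} and, for k = 1,…,n, T_k = T_{k−1} ∪ {v_k} if v_k ∈ S, or if v_k has at least one parent and every parent of v_k lies in T_{k−1}, and T_k = T_{k−1} otherwise. Then T_n = C(S). -/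
/-- A single pass in topological order computes the common-node closure.  The DAG has
vertices `v_1, …, v_n` identified with `Fin n` (0-based, `v_k ↔ ⟨k-1⟩`) in topological
order.  `T 0 = S`, and `T (k+1)` adds vertex `v_{k+1} = ⟨k⟩` to `T k` exactly when it
lies in `S`, or has at least one parent and all of its parents lie in `T k`.
Then `T n = C(S)`. -/
theorem single_pass_computes_commonClosure (n : ℕ) (adj : Fin n → Fin n → Prop)
    (htopo : ∀ i j : Fin n, adj i j → i < j)
    (S : Set (Fin n)) (T : ℕ → Set (Fin n))
    (hT0 : T 0 = S)
    (hTk : ∀ (k : ℕ) (hk : k < n),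
      (((⟨k, hk⟩ : Fin n) ∈ S ∨
          ((∃ p, adj p ⟨k, hk⟩) ∧ ∀ p, adj p ⟨k, hk⟩ → p ∈ T k)) →
        T (k + 1) = insert (⟨k, hk⟩ : Fin n) (T k)) ∧
      ((¬ ((⟨k, hk⟩ : Fin n) ∈ S ∨
          ((∃ p, adj p ⟨k, hk⟩) ∧ ∀ p, adj p ⟨k, hk⟩ → p ∈ T k))) →
        T (k + 1) = T k)) :
    T n = {v | CommonClosure adj S v} := by
  have invariant : ∀ k ≤ n, ∀ v : Fin n,
      v ∈ T k ↔ v ∈ S ∨ (v.val < k ∧ CommonClosure adj S v) := by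
    intro k
    induction k with
    | zero => simp [hT0]
    | succ k ih =>
      intro hk v
      have ih := ih (by omega)
      have parents_iff : ∀ p, adj p ⟨k, hk⟩ → (p ∈ T k ↔ CommonClosure adj S p) := by
        intro p hp
        rw [ih p]
        exact ⟨fun h => h.elim (.base p) And.right, fun h => .inr ⟨htopo _ _ hp, h⟩⟩
      have rule_iff : ((⟨k, hk⟩ : Fin n) ∈ S ∨
          ((∃ p, adj p ⟨k, hk⟩) ∧ ∀ p, adj p ⟨k, hk⟩ → p ∈ T k)) ↔
          CommonClosure adj S ⟨k, hk⟩ := by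
        constructor
        · rintro (h | ⟨hne, hp⟩)
          · exact .base _ h
          · exact .prop _ hne fun p h => (parents_iff p h).1 (hp p h)
        · rintro (⟨_, h⟩ | ⟨_, hne, hp⟩)
          · exact .inl h
          · exact .inr ⟨hne, fun p h => (parents_iff p h).2 (hp p h)⟩
      have hstep := hTk k hk
      rw [rule_iff] at hstep
      have hv : v.val < k + 1 ↔ v = ⟨k, hk⟩ ∨ v.val < k := by
        rw [Fin.ext_iff]
        dsimp only
        omega
      rw [hv]
      by_cases hc : CommonClosure adj S ⟨k, hk⟩
      · rw [hstep.1 hc, Set.mem_insert_iff, ih v]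
        by_cases h : v = ⟨k, hk⟩
        · simp [h, hc]
        · simp [h]
      · rw [hstep.2 hc, ih v]
        by_cases h : v = ⟨k, hk⟩
        · simp [h, hc]
        · simp [h]
  ext v
  rw [invariant n le_rfl v]
  exact ⟨fun h => h.elim (.base v) And.right, fun h => .inr ⟨v.isLt, h⟩⟩
end

section
/- Any sharding spec can be converted to any other by one-step transforms: for any two sharding specs σ and τ on the same tensor dimensions and device mesh, there exists a sequence of at most Σ_{i} |σ(i)| + Σ_{i} |τ(i)| one-step transforms (all-gathers and shards) taking σ to τ, where |σ(i)| denotes the length of the list σ(i). -/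
/-- A sharding spec on `n` tensor dimensions over a `d`-dimensional device mesh:
each tensor dimension `i` is assigned the list `dims i` of device-mesh axes along
which it is sharded; each list has no duplicates and the lists are pairwise disjoint
(each device-mesh axis shards at most one tensor dimension). -/
structure ShardingSpec (n d : ℕ) where
  dims : Fin n → List (Fin d)
  nodup : ∀ i, (dims i).Nodup
  disjoint : ∀ i j, i ≠ j → ∀ a, a ∈ dims i → a ∉ dims j

/-- A one-step transform replaces a sharding spec `σ` by a spec `σ'` agreeing with `σ`
in all but exactly one dimension `i`, where either (all-gather) `σ'(i)` is obtained
from `σ(i)` by deleting its last element, or (shard) `σ'(i)` is obtained from `σ(i)`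
by appending a device-mesh axis not occurring in any list `σ(j)`. -/
def OneStep {n d : ℕ} (σ σ' : ShardingSpec n d) : Prop :=
  ∃ i : Fin n,
    (∀ j, j ≠ i → σ'.dims j = σ.dims j) ∧
    ((σ.dims i ≠ [] ∧ σ'.dims i = (σ.dims i).dropLast) ∨
      (∃ a : Fin d, (∀ j, a ∉ σ.dims j) ∧ σ'.dims i = σ.dims i ++ [a]))

namespace ShardingSpec

variable {n d : ℕ}

@[ext]
theorem ext {σ τ : ShardingSpec n d} (h : ∀ i, σ.dims i = τ.dims i) : σ = τ := by
  cases σ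
  cases τ
  congr
  exact funext h

/-- The total number of device-mesh axes used by a sharding spec. -/
def size (σ : ShardingSpec n d) : ℕ := ∑ i, (σ.dims i).length

/-- All-gather along the tensor dimension `i`: delete the last axis of `σ.dims i`. -/
def gather (σ : ShardingSpec n d) (i : Fin n) : ShardingSpec n d where
  dims := Function.update σ.dims i (σ.dims i).dropLast
  nodup j := by
    rcases eq_or_ne j i with rfl | h
    · simpa using (σ.nodup j).sublist (List.dropLast_sublist _)
    · simpa [h] using σ.nodup j
  disjoint j k hjk a := by
    have key : ∀ l, a ∈ Function.update σ.dims i (σ.dims i).dropLast l → a ∈ σ.dims l := by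
      intro l hl
      rcases eq_or_ne l i with rfl | h
      · exact List.mem_of_mem_dropLast (by simpa using hl)
      · simpa [h] using hl
    exact fun hj hk => σ.disjoint j k hjk a (key j hj) (key k hk)

@[simp]
theorem gather_dims_self (σ : ShardingSpec n d) (i : Fin n) :
    (σ.gather i).dims i = (σ.dims i).dropLast := by
  simp [gather]

theorem gather_dims_of_ne (σ : ShardingSpec n d) {i j : Fin n} (h : j ≠ i) :
    (σ.gather i).dims j = σ.dims j := by
  simp [gather, h]

theorem size_gather_lt (σ : ShardingSpec n d) {i : Fin n} (h : σ.dims i ≠ []) :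
    (σ.gather i).size < σ.size := by
  refine Finset.sum_lt_sum (fun j _ => ?_) ⟨i, Finset.mem_univ i, ?_⟩
  · rcases eq_or_ne j i with rfl | hj
    · simp
    · rw [gather_dims_of_ne σ hj]
  · have := List.length_pos_iff.mpr h
    simp only [gather_dims_self, List.length_dropLast]
    omega

theorem oneStep_gather (σ : ShardingSpec n d) {i : Fin n} (h : σ.dims i ≠ []) :
    OneStep σ (σ.gather i) :=
  ⟨i, fun _ hj => gather_dims_of_ne σ hj, Or.inl ⟨h, gather_dims_self σ i⟩⟩

/-- An all-gather is undone by a shard. -/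
theorem gather_oneStep (σ : ShardingSpec n d) {i : Fin n} (h : σ.dims i ≠ []) :
    OneStep (σ.gather i) σ := by
  refine ⟨i, fun _ hj => (gather_dims_of_ne σ hj).symm,
    Or.inr ⟨(σ.dims i).getLast h, fun j => ?_, ?_⟩⟩
  · rcases eq_or_ne j i with rfl | hj
    · have hnd := σ.nodup j
      rw [← List.dropLast_append_getLast h, List.nodup_append] at hnd
      rw [gather_dims_self]
      exact fun hm => hnd.2.2 _ hm _ (List.mem_singleton_self _) rfl
    · rw [gather_dims_of_ne σ hj]
      exact σ.disjoint i j hj.symm _ (List.getLast_mem h)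
  · rw [gather_dims_self, List.dropLast_append_getLast]

/-- `ReachableIn k σ τ` says that some sequence of `k` one-step transforms takes `σ` to `τ`. -/
def ReachableIn (k : ℕ) (σ τ : ShardingSpec n d) : Prop :=
  ∃ f : ℕ → ShardingSpec n d, f 0 = σ ∧ f k = τ ∧ ∀ i < k, OneStep (f i) (f (i + 1))

theorem ReachableIn.head {k : ℕ} {σ ρ τ : ShardingSpec n d} (h : OneStep σ ρ)
    (hr : ReachableIn k ρ τ) : ReachableIn (k + 1) σ τ := by
  obtain ⟨f, rfl, rfl, hf⟩ := hr
  refine ⟨fun i => Nat.casesOn i σ f, rfl, rfl, fun i hi => ?_⟩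
  cases i with
  | zero => exact h
  | succ i => exact hf i (by omega)

theorem ReachableIn.tail {k : ℕ} {σ ρ τ : ShardingSpec n d} (hr : ReachableIn k σ ρ)
    (h : OneStep ρ τ) : ReachableIn (k + 1) σ τ := by
  obtain ⟨f, rfl, rfl, hf⟩ := hr
  refine ⟨fun i => if i ≤ k then f i else τ, by simp, by simp, fun i hi => ?_⟩
  rcases Nat.lt_succ_iff_lt_or_eq.mp hi with hlt | rfl
  · simpa [hlt.le, Nat.succ_le_of_lt hlt] using hf i hlt
  · simpa using h

theorem exists_reachableIn_le (σ τ : ShardingSpec n d) :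
    ∃ k ≤ σ.size + τ.size, ReachableIn k σ τ := by
  induction hm : σ.size + τ.size using Nat.strong_induction_on generalizing σ τ with
  | _ m ih =>
    by_cases hσ : ∃ i, σ.dims i ≠ []
    · obtain ⟨i, hi⟩ := hσ
      have hlt := σ.size_gather_lt hi
      obtain ⟨k, hk, hr⟩ := ih _ (by omega) (σ.gather i) τ rfl
      exact ⟨k + 1, by omega, hr.head (σ.oneStep_gather hi)⟩
    by_cases hτ : ∃ i, τ.dims i ≠ []
    · obtain ⟨i, hi⟩ := hτ
      have hlt := τ.size_gather_lt hi
      obtain ⟨k, hk, hr⟩ := ih _ (by omega) σ (τ.gather i) rfl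
      exact ⟨k + 1, by omega, hr.tail (τ.gather_oneStep hi)⟩
    push Not at hσ hτ
    obtain rfl : σ = τ := ShardingSpec.ext fun i => (hσ i).trans (hτ i).symm
    exact ⟨0, Nat.zero_le _, fun _ => σ, rfl, rfl, fun _ hi => absurd hi (Nat.not_lt_zero _)⟩

end ShardingSpec

/-- Any sharding spec can be converted to any other by one-step transforms:
for any specs `σ` and `τ` on the same tensor dimensions and device mesh, there is a
sequence of at most `Σ_i |σ(i)| + Σ_i |τ(i)|` one-step transforms (all-gathers and
shards) taking `σ` to `τ`. -/
theorem shardingSpec_reachable (n d : ℕ) (hn : 1 ≤ n) (hd : 1 ≤ d)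
    (σ τ : ShardingSpec n d) :
    ∃ (k : ℕ) (f : ℕ → ShardingSpec n d),
      f 0 = σ ∧ f k = τ ∧
      (∀ i < k, OneStep (f i) (f (i + 1))) ∧
      k ≤ (∑ i, (σ.dims i).length) + (∑ i, (τ.dims i).length) := by
  obtain ⟨k, hk, f, h0, hf, hstep⟩ := σ.exists_reachableIn_le τ
  exact ⟨k, f, h0, hf, hstep, hk⟩
end
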